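/- arXiv:1406.0263 — 5 statements merged into one kernel-verified Lean document; each statement's English description precedes it below -/
import Mathlib

section
/- Every string w of length n that contains exactly d distinct symbols, where n > 2d, has at most n − d − 1 runs; in particular, ρ(n,d) ≤ n − d − 1 whenever n > 2d, where ρ(n,d) is the maximum number of runs in a string of length n containing exactly d distinct symbols. -/
variable {α : Type*}

/-- The substring `w[i..j]` of a 1-indexed string given as a function `w : ℕ → α`. -/
def substr (w : ℕ → α) (i j : ℕ) : List α :=
  (List.range (j + 1 - i)).map (fun k => w (i + k))

/-- `u` is a Lyndon word w.r.t. the strict order `lt`: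
`u` is nonempty and lexicographically smaller than each of its nonempty proper suffixes. -/
def IsLyndon (lt : α → α → Prop) (u : List α) : Prop :=
  u ≠ [] ∧ ∀ v, v ≠ [] → v ≠ u → v <:+ u → List.Lex lt u v

/-- `p` is a period of the substring `w[i..j]`. -/
def IsPeriod (w : ℕ → α) (i j p : ℕ) : Prop :=
  ∀ k, i ≤ k → k + p ≤ j → w k = w (k + p)

/-- `(i,j,p)` is a run of the string `w[1..n]`. -/
def IsRun (w : ℕ → α) (n i j p : ℕ) : Prop :=
  1 ≤ i ∧ j ≤ n ∧ 1 ≤ p ∧ i + 2 * p ≤ j + 1 ∧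
  IsPeriod w i j p ∧ (∀ q, 1 ≤ q → q < p → ¬ IsPeriod w i j q) ∧
  (i = 1 ∨ w (i - 1) ≠ w (i + p - 1)) ∧
  (j = n ∨ w (j + 1) ≠ w (j - p + 1))

/-- The set of runs of the string `w[1..n]`, as triples `(i,j,p)`. -/
def Runs (w : ℕ → α) (n : ℕ) : Set (ℕ × ℕ × ℕ) :=
  { r | IsRun w n r.1 r.2.1 r.2.2 }

/-- The exponent of a run `(i,j,p)`, i.e. `(j-i+1)/p`, as a rational number. -/
def expo (r : ℕ × ℕ × ℕ) : ℚ :=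
  ((r.2.1 : ℚ) - (r.1 : ℚ) + 1) / (r.2.2 : ℚ)

/-- `ŵ = w$`: positions `1..n` carry `w`, position `n+1` carries the sentinel `none`. -/
def hat (w : ℕ → α) (n : ℕ) : ℕ → Option α :=
  fun i => if i ≤ n then some (w i) else none

/-- Extension of a strict order `lt` on `α` to `Option α`, where the sentinel `none`
is smaller than every letter if `small = true`, and larger otherwise. -/
def extLT (small : Bool) (lt : α → α → Prop) : Option α → Option α → Prop
  | none, none => False
  | none, some _ => small = true
  | some _, none => small = false
  | some a, some b => lt a b

/-- The order `≺_ℓ` on `Σ ∪ {$}` (for `ℓ ∈ {0,1}` encoded as `Bool`):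
`$ ≺₀ a` and `a ≺₁ $` for every `a ∈ Σ`. -/
def hatOrd (lt0 lt1 : α → α → Prop) (ℓ : Bool) : Option α → Option α → Prop :=
  extLT (!ℓ) (cond ℓ lt1 lt0)

/-- `[i..j] = λ_ℓ(i)`: `ŵ[i..j]` is the longest Lyndon word (w.r.t. `lt`)
starting at position `i` in `ŵ = ŵ[1..n+1]`. -/
def IsLongestLyndon (lt : Option α → Option α → Prop) (what : ℕ → Option α)
    (n i j : ℕ) : Prop :=
  i ≤ j ∧ j ≤ n + 1 ∧ IsLyndon lt (substr what i j) ∧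
  ∀ j', j < j' → j' ≤ n + 1 → ¬ IsLyndon lt (substr what i j')

/-- `[iℓ..jℓ]` is an L-root of the run `(i,j,p)` w.r.t. `lt`. -/
def IsLRoot (lt : α → α → Prop) (w : ℕ → α) (i j p iℓ jℓ : ℕ) : Prop :=
  i ≤ iℓ ∧ jℓ ≤ j ∧ jℓ + 1 = iℓ + p ∧ IsLyndon lt (substr w iℓ jℓ)

/-- The set `B_r` for the run `r = (i,j,p)` of `w[1..n]`: all L-roots
(as intervals, i.e. pairs `(iλ, jλ)`) of `r` w.r.t. the unique order `≺_ℓ`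
with `ŵ[j+1] ≺_ℓ ŵ[j+1-p]`, except those starting at `i`. -/
def Br (lt0 lt1 : α → α → Prop) (w : ℕ → α) (n i j p : ℕ) : Set (ℕ × ℕ) :=
  { q | ∃ ℓ : Bool, hatOrd lt0 lt1 ℓ (hat w n (j + 1)) (hat w n (j + 1 - p)) ∧
        IsLRoot (cond ℓ lt1 lt0) w i j p q.1 q.2 ∧ q.1 ≠ i }

/-- `p` is a period of the list `s` (0-indexed form of `s[k] = s[k+p]` for `1 ≤ k ≤ |s|-p`). -/
def ListPeriod (s : List α) (p : ℕ) : Prop :=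
  ∀ k, k + p < s.length → s[k]? = s[k + p]?

/-- The factor `h[k..k+p-1]` is strictly smaller, at a mismatch, than each of its proper suffixes. -/
def LyndonAt (h : ℕ → ℤ) (k p : ℕ) : Prop :=
  ∀ m, 0 < m → m < p → ∃ t, t + m < p ∧ (∀ x < t, h (k + x) = h (k + m + x)) ∧
    h (k + t) < h (k + m + t)

/-- A run `(i,j,p)` of an integer sequence that always breaks at position `j + 1`. -/
structure SeqRun (g : ℕ → ℤ) (i j p : ℕ) : Prop where
  one_le : 1 ≤ i
  pos : 1 ≤ p
  two_mul_le : i + 2 * p ≤ j + 1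
  period : IsPeriod g i j p
  minimal : ∀ q, 1 ≤ q → q < p → ¬ IsPeriod g i j q
  left : i = 1 ∨ g (i - 1) ≠ g (i + p - 1)
  right : g (j + 1) ≠ g (j + 1 - p)

/-- Position `k` starts the first Lyndon root, after position `i`, of the run `(i,j,p)`, for the
order in which the run breaks downwards. -/
structure RootAt (h : ℕ → ℤ) (i j p k : ℕ) : Prop where
  lt : i < k
  le : k ≤ i + p
  lyndon : LyndonAt h k p
  drop : h (j + 1) < h (j + 1 - p)

theorem SeqRun.neg {g : ℕ → ℤ} {i j p : ℕ} (hr : SeqRun g i j p) :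
    SeqRun (fun x => -g x) i j p where
  one_le := hr.one_le
  pos := hr.pos
  two_mul_le := hr.two_mul_le
  period k h1 h2 := by simpa using hr.period k h1 h2
  minimal q h1 h2 h3 := hr.minimal q h1 h2 fun k h4 h5 => by simpa using h3 k h4 h5
  left := by simpa using hr.left
  right := by simpa using hr.right

theorem LyndonAt.le {h : ℕ → ℤ} {k p m : ℕ} (hl : LyndonAt h k p) (hm : m < p) :
    h k ≤ h (k + m) := by
  rcases Nat.eq_zero_or_pos m with rfl | h0
  · simp
  obtain ⟨t, -, h2, h3⟩ := hl m h0 hm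
  rcases Nat.eq_zero_or_pos t with rfl | ht
  · simpa using h3.le
  · simpa using (h2 0 ht).le

theorem LyndonAt.lt_last {h : ℕ → ℤ} {k p : ℕ} (hl : LyndonAt h k p) (hp : 2 ≤ p) :
    h k < h (k + p - 1) := by
  obtain ⟨t, h1, -, h3⟩ := hl (p - 1) (by omega) (by omega)
  obtain rfl : t = 0 := by omega
  have e : k + p - 1 = k + (p - 1) := by omega
  simpa [e] using h3

theorem exists_lyndonAt_of_periodic (H : ℕ → ℤ) (i p : ℕ) (hp : 1 ≤ p)
    (hper : ∀ x, H (x + p) = H x)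
    (hmin : ∀ m, 0 < m → m < p → ¬ ∀ x, i ≤ x → H x = H (x + m)) :
    ∃ k, i < k ∧ k ≤ i + p ∧ LyndonAt H k p := by
  let f : ℕ → Lex (ℕ → ℤ) := fun k => toLex (fun x => H (k + x))
  obtain ⟨k, hk, hkmin⟩ := Finset.exists_min_image (Finset.Ioc i (i + p)) f
    ⟨i + 1, by simp; omega⟩
  simp only [Finset.mem_Ioc] at hk hkmin
  have fper : ∀ x, f (x + p) = f x := fun x => by
    simp only [f]
    congr 1
    funext y
    rw [show x + p + y = x + y + p by ring, hper]
  have hall : ∀ m, m < p → f k ≤ f (k + m) := by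
    intro m hm
    by_cases hc : k + m ≤ i + p
    · exact hkmin _ ⟨by omega, hc⟩
    · have := hkmin (k + m - p) ⟨by omega, by omega⟩
      rwa [← fper (k + m - p), Nat.sub_add_cancel (by omega)] at this
  refine ⟨k, hk.1, hk.2, fun m h0 hm => ?_⟩
  have hne : f k ≠ f (k + m) := by
    intro he
    have he' : ∀ x, H (k + x) = H (k + m + x) := fun x => congrFun (congrArg ofLex he) x
    refine hmin m h0 hm fun x hx => ?_
    have h1 := he' (x + p - k)
    rw [show k + (x + p - k) = x + p by omega, show k + m + (x + p - k) = x + m + p by omega,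
      hper, hper] at h1
    exact h1
  obtain ⟨t, ht1, ht2⟩ : ∃ t, (∀ x < t, H (k + x) = H (k + m + x)) ∧
      H (k + t) < H (k + m + t) := lt_of_le_of_ne (hall m hm) hne
  refine ⟨t, ?_, ht1, ht2⟩
  by_contra hc
  have hlt : f (k + (p - m)) < f k := by
    refine ⟨t - (p - m), fun x hx => ?_, ?_⟩
    · have := ht1 (x + (p - m)) (by omega)
      rw [show k + m + (x + (p - m)) = k + x + p by omega, hper] at this
      simpa [f, add_assoc, add_comm, add_left_comm] using this
    · have := ht2
      rw [show k + m + t = k + (t - (p - m)) + p by omega, hper] at this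
      change H (k + (p - m) + (t - (p - m))) < H (k + (t - (p - m)))
      rwa [show k + (p - m) + (t - (p - m)) = k + t by omega]
  exact absurd (hall (p - m) (by omega)) (not_le.mpr hlt)

theorem SeqRun.exists_rootAt_of_drop {h : ℕ → ℤ} {i j p : ℕ} (hr : SeqRun h i j p)
    (hd : h (j + 1) < h (j + 1 - p)) : ∃ k, RootAt h i j p k := by
  have hp := hr.pos
  have hlen := hr.two_mul_le
  -- the periodic extension of the run
  let H : ℕ → ℤ := fun x => h (i + (x + (p - 1) * i) % p)
  have hper : ∀ x, H (x + p) = H x := fun x => by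
    simp only [H]
    rw [show x + p + (p - 1) * i = x + (p - 1) * i + p by ring, Nat.add_mod_right]
  have hHi : ∀ y, y < p → H (i + y) = h (i + y) := fun y hy => by
    simp only [H]
    obtain ⟨q, rfl⟩ : ∃ q, p = q + 1 := ⟨p - 1, by omega⟩
    rw [show i + y + (q + 1 - 1) * i = y + (q + 1) * i by simp; ring, Nat.add_mul_mod_self_left,
      Nat.mod_eq_of_lt hy]
  have hH : ∀ y, i + y ≤ j → H (i + y) = h (i + y) := by
    intro y
    induction y using Nat.strong_induction_on with
    | _ y ih =>
      intro hy
      by_cases hc : y < p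
      · exact hHi y hc
      · have h1 := ih (y - p) (by omega) (by omega)
        have h2 := hper (i + (y - p))
        have h3 := hr.period (i + (y - p)) (by omega) (by omega)
        rw [show i + (y - p) + p = i + y by omega] at h2 h3
        rw [h2, h1, h3]
  have hH' : ∀ x, i ≤ x → x ≤ j → H x = h x := fun x h1 h2 => by
    have := hH (x - i) (by omega)
    rwa [Nat.add_sub_cancel' h1] at this
  obtain ⟨k, h1, h2, h3⟩ := exists_lyndonAt_of_periodic H i p hp hper (by
    intro m h0 hm hall
    refine hr.minimal m h0 hm fun x h1 h2 => ?_
    rw [← hH' x h1 (by omega), ← hH' (x + m) (by omega) h2]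
    exact hall x h1)
  refine ⟨k, h1, h2, fun m h0 hm => ?_, hd⟩
  obtain ⟨t, a, b, c⟩ := h3 m h0 hm
  refine ⟨t, a, fun x hx => ?_, ?_⟩
  · have := b x hx
    rwa [hH' _ (by omega) (by omega), hH' _ (by omega) (by omega)] at this
  · rwa [hH' _ (by omega) (by omega), hH' _ (by omega) (by omega)] at c

theorem SeqRun.exists_rootAt {g : ℕ → ℤ} {i j p : ℕ} (hr : SeqRun g i j p) :
    ∃ k, RootAt g i j p k ∨ RootAt (fun x => -g x) i j p k := by
  rcases lt_or_gt_of_ne hr.right with h | h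
  · obtain ⟨k, hk⟩ := hr.exists_rootAt_of_drop h
    exact ⟨k, Or.inl hk⟩
  · obtain ⟨k, hk⟩ := hr.neg.exists_rootAt_of_drop (neg_lt_neg h)
    exact ⟨k, Or.inr hk⟩

theorem SeqRun.apply_pred_root {g h : ℕ → ℤ} {i j p k : ℕ} (hr : SeqRun g i j p)
    (hk : RootAt h i j p k) : g (k - 1) = g (k + p - 1) := by
  have h1 := hk.lt
  have h2 := hk.le
  have h3 := hr.two_mul_le
  have h4 := hr.period (k - 1) (by omega) (by omega)
  rwa [show k - 1 + p = k + p - 1 by omega] at h4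

theorem not_lyndonAt_of_rootAt {h : ℕ → ℤ} {i j p q k : ℕ} (hr : SeqRun h i j p)
    (hk : RootAt h i j p k) (hq : p < q) : ¬ LyndonAt h k q := by
  intro hl
  have h1 := hk.lt
  have h2 := hk.le
  have h3 := hr.two_mul_le
  have hper : ∀ x, k + p + x ≤ j → h (k + x) = h (k + p + x) := fun x hx => by
    have := hr.period (k + x) (by omega) (by omega)
    rwa [show k + x + p = k + p + x by ring] at this
  obtain ⟨t, a, b, c⟩ := hl p hr.pos hq
  rcases le_or_gt (k + p + t) j with ht | ht
  · exact c.ne (hper t ht)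
  · have hd := hk.drop
    have e1 : j + 1 = k + p + (j + 1 - (k + p)) := by omega
    have e2 : j + 1 - p = k + (j + 1 - (k + p)) := by omega
    rw [e2] at hd
    rw [e1] at hd
    have hs : k + (k + p + (j + 1 - (k + p)) - (k + p)) = k + (j + 1 - (k + p)) := by omega
    rw [hs] at hd
    rcases lt_or_eq_of_le (show j + 1 - (k + p) ≤ t by omega) with hlt | heq
    · exact hd.ne' (b _ hlt)
    · rw [heq] at hd
      exact lt_asymm hd c

theorem SeqRun.period_eq_of_rootAt {h : ℕ → ℤ} {i j p i' j' p' k : ℕ} (hr : SeqRun h i j p)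
    (hr' : SeqRun h i' j' p') (hk : RootAt h i j p k) (hk' : RootAt h i' j' p' k) : p = p' := by
  rcases lt_trichotomy p p' with h1 | h1 | h1
  · exact absurd hk'.lyndon (not_lyndonAt_of_rootAt hr hk h1)
  · exact h1
  · exact absurd hk.lyndon (not_lyndonAt_of_rootAt hr' hk' h1)

theorem SeqRun.period_eq_of_rootAt_neg {g : ℕ → ℤ} {i j p i' j' p' k : ℕ} (hr : SeqRun g i j p)
    (hr' : SeqRun g i' j' p') (hk : RootAt g i j p k)
    (hk' : RootAt (fun x => -g x) i' j' p' k) : p = p' := by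
  have h1 := hr.apply_pred_root hk
  have h2 := hr'.apply_pred_root hk'
  have hp := hr.pos
  have hp' := hr'.pos
  rcases Nat.lt_or_ge p 2 with h | h <;> rcases Nat.lt_or_ge p' 2 with h' | h'
  · omega
  · have h3 := hk'.lyndon.lt_last h'
    obtain rfl : p = 1 := by omega
    simp at h1 h3
    omega
  · have h3 := hk.lyndon.lt_last h
    obtain rfl : p' = 1 := by omega
    simp at h2 h3
    omega
  · have h3 := hk.lyndon.lt_last h
    have h4 := hk'.lyndon.lt_last h'
    simp at h4
    omega

theorem SeqRun.start_le {g : ℕ → ℤ} {i j i' j' p k : ℕ} (hr : SeqRun g i j p)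
    (hr' : SeqRun g i' j' p) (hk' : i' < k) (hj : k + p ≤ j + 1) : i' ≤ i := by
  by_contra hc
  have h1 := hr.one_le
  rcases hr'.left with h | h
  · omega
  · have := hr.period (i' - 1) (by omega) (by omega)
    rw [show i' - 1 + p = i' + p - 1 by omega] at this
    exact h this

theorem SeqRun.stop_le {g : ℕ → ℤ} {i j i' j' p k : ℕ} (hr : SeqRun g i j p)
    (hr' : SeqRun g i' j' p) (hk : i < k) (hj' : k + p ≤ j' + 1) : j ≤ j' := by
  by_contra hc
  have := hr.period (j' + 1 - p) (by omega) (by omega)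
  rw [Nat.sub_add_cancel (by omega)] at this
  exact hr'.right this.symm

theorem SeqRun.ext_of_root {g h h' : ℕ → ℤ} {i j i' j' p k : ℕ} (hr : SeqRun g i j p)
    (hr' : SeqRun g i' j' p) (hk : RootAt h i j p k) (hk' : RootAt h' i' j' p k) :
    i = i' ∧ j = j' := by
  have a := hk.lt
  have b := hk.le
  have c := hk'.lt
  have d := hk'.le
  have e := hr.two_mul_le
  have f := hr'.two_mul_le
  exact ⟨le_antisymm (hr'.start_le hr a (by omega)) (hr.start_le hr' c (by omega)),
    le_antisymm (hr.stop_le hr' a (by omega)) (hr'.stop_le hr c (by omega))⟩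

/-- `k` starts a Lyndon root of the run `(i,j,p)` for one of the two opposite orders. -/
def IsRootStart (g : ℕ → ℤ) (i j p k : ℕ) : Prop :=
  RootAt g i j p k ∨ RootAt (fun x => -g x) i j p k

theorem SeqRun.ext_of_isRootStart {g : ℕ → ℤ} {i j p i' j' p' k : ℕ} (hr : SeqRun g i j p)
    (hr' : SeqRun g i' j' p') (hk : IsRootStart g i j p k) (hk' : IsRootStart g i' j' p' k) :
    i = i' ∧ j = j' ∧ p = p' := by
  have hp : p = p' := by
    rcases hk with hk | hk <;> rcases hk' with hk' | hk'
    · exact hr.period_eq_of_rootAt hr' hk hk'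
    · exact hr.period_eq_of_rootAt_neg hr' hk hk'
    · exact (hr'.period_eq_of_rootAt_neg hr hk' hk).symm
    · exact hr.neg.period_eq_of_rootAt hr'.neg hk hk'
  subst hp
  have : i = i' ∧ j = j' := by
    rcases hk with hk | hk <;> rcases hk' with hk' | hk' <;> exact hr.ext_of_root hr' hk hk'
  exact ⟨this.1, this.2, rfl⟩

theorem IsRootStart.lt {g : ℕ → ℤ} {i j p k : ℕ} (hk : IsRootStart g i j p k) : i < k :=
  hk.elim (·.lt) (·.lt)

theorem IsRootStart.le {g : ℕ → ℤ} {i j p k : ℕ} (hk : IsRootStart g i j p k) : k ≤ i + p :=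
  hk.elim (·.le) (·.le)

theorem IsRootStart.apply_ne_last {g : ℕ → ℤ} {i j p k : ℕ} (hk : IsRootStart g i j p k)
    (hp : 2 ≤ p) : g k ≠ g (k + p - 1) := by
  rcases hk with hk | hk
  · exact (hk.lyndon.lt_last hp).ne
  · have := hk.lyndon.lt_last hp
    simp at this
    exact this.ne'

theorem SeqRun.apply_pred_rootStart {g : ℕ → ℤ} {i j p k : ℕ} (hr : SeqRun g i j p)
    (hk : IsRootStart g i j p k) : g (k - 1) = g (k + p - 1) :=
  hk.elim hr.apply_pred_root hr.apply_pred_root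

/-- If `g x ≥ x` is the last occurrence of the letter at `x`, then no root starts at the beginning
of the last block of a letter. -/
theorem SeqRun.not_isRootStart_of_block {g : ℕ → ℕ} (hg : ∀ x, x ≤ g x) {i j p s : ℕ}
    (hr : SeqRun (fun x => (g x : ℤ)) i j p) (hs : s = 1 ∨ g (s - 1) ≠ g s)
    (hb : ∀ x, s ≤ x → x ≤ g s → g x = g s) :
    ¬ IsRootStart (fun x => (g x : ℤ)) i j p s := by
  intro hk
  have h1 := hr.one_le
  have h2 := hk.lt
  have h2' := hk.le
  have h3 := hr.apply_pred_rootStart hk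
  have h4 := hr.two_mul_le
  have hp := hr.pos
  simp only [Nat.cast_inj] at h3
  have hne : g (s - 1) ≠ g s := hs.resolve_left (by omega)
  have hp2 : 2 ≤ p := by
    by_contra hc
    obtain rfl : p = 1 := by omega
    exact hne h3
  have h5 : g s < s + p - 1 := by
    by_contra hc
    exact hne (h3.trans (hb _ (by omega) (by omega)))
  have h6 : j + 1 = s + p := by
    by_contra hc
    have h7 := hr.period s (by omega) (by omega)
    simp only [Nat.cast_inj] at h7
    have := hg (s + p)
    omega
  have h8 := hg (s + p)
  have h9 := hg (s + p - 1)
  rcases hk with hk | hk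
  · have := hk.drop
    rw [h6, Nat.add_sub_cancel] at this
    simp only [Nat.cast_lt] at this
    omega
  · have := hk.lyndon.lt_last hp2
    simp only [neg_lt_neg_iff, Nat.cast_lt] at this
    omega

/-- The last position in `[0..n]` carrying the letter at position `x ≤ n`; positions beyond `n`
are sent to themselves. -/
noncomputable def lastOcc {α : Type*} (w : ℕ → α) (n x : ℕ) : ℕ :=
  open Classical in if x ≤ n then Nat.findGreatest (fun y => w y = w x) n else x

theorem le_lastOcc {α : Type*} (w : ℕ → α) (n x : ℕ) : x ≤ lastOcc w n x := by
  unfold lastOcc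
  split_ifs with h
  · classical exact Nat.le_findGreatest (P := fun y => w y = w x) h rfl
  · exact le_rfl

theorem lastOcc_le {α : Type*} (w : ℕ → α) {n x : ℕ} (h : x ≤ n) : lastOcc w n x ≤ n := by
  unfold lastOcc
  rw [if_pos h]
  classical exact Nat.findGreatest_le n

theorem lastOcc_of_lt {α : Type*} (w : ℕ → α) {n x : ℕ} (h : n < x) : lastOcc w n x = x := by
  unfold lastOcc
  rw [if_neg (by omega)]

theorem apply_lastOcc {α : Type*} (w : ℕ → α) (n x : ℕ) : w (lastOcc w n x) = w x := by
  unfold lastOcc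
  split_ifs with h
  · classical exact Nat.findGreatest_spec (P := fun y => w y = w x) h rfl
  · rfl

theorem lastOcc_eq_iff {α : Type*} (w : ℕ → α) {n x y : ℕ} (hx : x ≤ n) (hy : y ≤ n) :
    lastOcc w n x = lastOcc w n y ↔ w x = w y := by
  constructor
  · intro h
    rw [← apply_lastOcc w n x, h, apply_lastOcc w n y]
  · intro h
    unfold lastOcc
    rw [if_pos hx, if_pos hy, h]

theorem IsRun.seqRun {α : Type*} {w : ℕ → α} {n i j p : ℕ} (hr : IsRun w n i j p) :
    SeqRun (fun x => (lastOcc w n x : ℤ)) i j p := by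
  obtain ⟨h1, h2, h3, h4, h5, h6, h7, h8⟩ := hr
  refine ⟨h1, h3, h4, fun k a b => ?_, fun q a b c => h6 q a b fun k d e => ?_, ?_, ?_⟩
  · simp only [Nat.cast_inj]
    exact (lastOcc_eq_iff w (by omega) (by omega)).2 (h5 k a b)
  · have := c k d e
    simp only [Nat.cast_inj] at this
    exact (lastOcc_eq_iff w (by omega) (by omega)).1 this
  · refine h7.imp_right fun h e => h ?_
    simp only [Nat.cast_inj] at e
    exact (lastOcc_eq_iff w (by omega) (by omega)).1 e
  · simp only [ne_eq, Nat.cast_inj]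
    intro e
    rcases Nat.lt_or_ge j n with hj | hj
    · have e' := (lastOcc_eq_iff w (by omega) (by omega)).1 e
      rcases h8 with h8 | h8
      · omega
      · rw [show j + 1 - p = j - p + 1 by omega] at e'
        exact h8 e'
    · rw [lastOcc_of_lt w (by omega : n < j + 1)] at e
      have := lastOcc_le w (by omega : j + 1 - p ≤ n)
      omega

/-- Some position `x` has an equal letter at distance at least two to the right, by counting. -/
theorem exists_add_two_le_lastOcc {α : Type*} [DecidableEq α] (w : ℕ → α) (n : ℕ)
    (hn : 2 * ((Finset.Icc 1 n).image w).card < n) :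
    ∃ x, 1 ≤ x ∧ x + 2 ≤ lastOcc w n x := by
  by_contra! hc
  have := Finset.card_le_mul_card_image (f := w) (Finset.Icc 1 n) 2 (by
    intro a ha
    obtain ⟨y, hy, rfl⟩ := Finset.mem_image.1 ha
    rw [Finset.mem_Icc] at hy
    refine (Finset.card_le_card (t := {lastOcc w n y - 1, lastOcc w n y}) ?_).trans
      Finset.card_le_two
    intro x hx
    simp only [Finset.mem_filter, Finset.mem_Icc] at hx
    have h1 := (lastOcc_eq_iff w hx.1.2 hy.2).2 hx.2
    have h2 := hc x hx.1.1
    have h3 := le_lastOcc w n x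
    simp only [Finset.mem_insert, Finset.mem_singleton]
    omega)
  simp at this
  omega

/-- Every letter of `w[1..n]` has a last block. -/
theorem exists_start_lastBlock {α : Type*} (w : ℕ → α) {n y : ℕ} (h1 : 1 ≤ y) (hn : y ≤ n) :
    ∃ s, 1 ≤ s ∧ s ≤ n ∧ w s = w y ∧ (s = 1 ∨ lastOcc w n (s - 1) ≠ lastOcc w n s) ∧
      ∀ x, s ≤ x → x ≤ lastOcc w n s → lastOcc w n x = lastOcc w n s := by
  classical
  have hv : lastOcc w n y ≤ n := lastOcc_le w hn
  have hyv := le_lastOcc w n y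
  have hvv : lastOcc w n (lastOcc w n y) = lastOcc w n y :=
    (lastOcc_eq_iff w hv hn).2 (apply_lastOcc w n y)
  have hex : ∃ s, 1 ≤ s ∧ s ≤ lastOcc w n y ∧
      ∀ x, s ≤ x → x ≤ lastOcc w n y → lastOcc w n x = lastOcc w n y :=
    ⟨lastOcc w n y, by omega, le_rfl, fun x a b => by rw [le_antisymm b a, hvv]⟩
  obtain ⟨a, b, c⟩ := Nat.find_spec hex
  have hmin := fun m hm => Nat.find_min (m := m) hex hm
  generalize Nat.find hex = s at a b c hmin
  have hs := c s le_rfl b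
  refine ⟨s, a, by omega, (lastOcc_eq_iff w (by omega) hn).1 hs, ?_, by rwa [hs]⟩
  by_contra! hc
  refine hmin (s - 1) (by omega) ⟨by omega, by omega, fun x hx hx' => ?_⟩
  rcases Nat.lt_or_ge x s with hlt | hge
  · rw [show x = s - 1 by omega, hc.2, hs]
  · exact c x hge hx'

theorem runs_stmt10 {α : Type*} (n d : ℕ) (w : ℕ → α)
    (hd : {a : α | ∃ i, 1 ≤ i ∧ i ≤ n ∧ w i = a}.ncard = d)
    (hnd : 2 * d < n) :
    (Runs w n).ncard ≤ n - d - 1 := by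
  classical
  have hset : {a : α | ∃ i, 1 ≤ i ∧ i ≤ n ∧ w i = a} = ↑((Finset.Icc 1 n).image w) := by
    ext a
    simp [and_assoc]
  have hcard : ((Finset.Icc 1 n).image w).card = d := by
    rw [← hd, hset, Set.ncard_coe_finset]
  set g : ℕ → ℕ := lastOcc w n with hgdef
  have hg : ∀ x, x ≤ g x := le_lastOcc w n
  have hgn : ∀ x, n < x → g x = x := fun x hx => lastOcc_of_lt w hx
  let S : Finset ℕ := (Finset.Icc 1 n).filter fun s =>
    (s = 1 ∨ g (s - 1) ≠ g s) ∧ ∀ x, s ≤ x → x ≤ g s → g x = g s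
  have hS : d ≤ S.card := by
    rw [← hcard]
    refine (Finset.card_le_card (t := S.image w) ?_).trans Finset.card_image_le
    intro a ha
    obtain ⟨y, hy, rfl⟩ := Finset.mem_image.1 ha
    rw [Finset.mem_Icc] at hy
    obtain ⟨s, h1, h2, h3, h4⟩ := exists_start_lastBlock w hy.1 hy.2
    exact Finset.mem_image.2 ⟨s, Finset.mem_filter.2 ⟨Finset.mem_Icc.2 ⟨h1, h2⟩, h4⟩, h3⟩
  have hrun : ∀ r ∈ Runs w n, SeqRun (fun x => (g x : ℤ)) r.1 r.2.1 r.2.2 :=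
    fun r hr => IsRun.seqRun hr
  obtain ⟨e, he1, hen, heS, he⟩ : ∃ e, 1 ≤ e ∧ e ≤ n ∧ e ∉ S ∧
      ∀ i j p, SeqRun (fun x => (g x : ℤ)) i j p →
        ¬ IsRootStart (fun x => (g x : ℤ)) i j p e := by
    have hex := exists_add_two_le_lastOcc w n (by rw [hcard]; exact hnd)
    obtain ⟨ht1, ht2⟩ := Nat.find_spec hex
    have hmin := fun m hm => Nat.find_min (m := m) hex hm
    generalize Nat.find hex = t at ht1 ht2 hmin
    change t + 2 ≤ g t at ht2
    have htn : t ≤ n := by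
      by_contra hc
      have := hgn t (by omega)
      omega
    have hgt : g t ≤ n := lastOcc_le w htn
    by_cases htS : t ∈ S
    · have hb := (Finset.mem_filter.1 htS).2.2
      have e1 := hb (t + 1) (by omega) (by omega)
      have e2 := hb (t + 2) (by omega) (by omega)
      refine ⟨t + 2, by omega, by omega, fun h => ?_, fun i j p hr hk => ?_⟩
      · have := (Finset.mem_filter.1 h).2.1
        simp [e1, e2] at this
      · have h1 := hr.apply_pred_rootStart hk
        have h2 := hk.lt
        have h3 := hk.le
        have hp := hr.pos
        rcases Nat.lt_or_ge p 2 with h | h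
        · obtain rfl : p = 1 := by omega
          obtain rfl : i = t + 1 := by omega
          have := hr.left
          simp [e1] at this
          omega
        · refine hk.apply_ne_last h ?_
          rw [← h1]
          simp [e1, e2]
    · refine ⟨t, ht1, htn, htS, fun i j p hr hk => ?_⟩
      have h1 := hr.apply_pred_rootStart hk
      have h2 := hk.lt
      have h3 := hr.one_le
      have hp := hr.pos
      simp only [Nat.cast_inj] at h1
      have h4 : ¬ (t - 1 + 2 ≤ g (t - 1)) := fun h => hmin (t - 1) (by omega) ⟨by omega, h⟩
      have h5 := hg (t + p - 1)
      obtain rfl : p = 1 := by omega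
      simp only [Nat.add_sub_cancel] at h1
      omega
  have hex : ∀ r ∈ Runs w n, ∃ k, IsRootStart (fun x => (g x : ℤ)) r.1 r.2.1 r.2.2 k :=
    fun r hr => (hrun r hr).exists_rootAt
  choose! F hF using hex
  let T : Finset ℕ := Finset.Icc 1 n \ insert e S
  have hle : (Runs w n).ncard ≤ (T : Set ℕ).ncard := by
    refine Set.ncard_le_ncard_of_injOn F (fun r hr => ?_) (fun r hr r' hr' h => ?_)
      T.finite_toSet
    · have h1 := (hF r hr).lt
      have h2 := (hF r hr).le
      have h3 := (hrun r hr).two_mul_le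
      have h4 : r.2.1 ≤ n := hr.2.1
      have h5 := (hrun r hr).pos
      simp only [T, Finset.coe_sdiff, Set.mem_sdiff, Finset.mem_coe, Finset.mem_Icc,
        Finset.mem_insert, not_or]
      refine ⟨⟨by omega, by omega⟩, fun h => ?_, fun h => ?_⟩
      · exact he _ _ _ (hrun r hr) (h ▸ hF r hr)
      · have h6 := (Finset.mem_filter.1 h).2
        exact (hrun r hr).not_isRootStart_of_block hg h6.1 h6.2 (hF r hr)
    · have h1 := hF r hr
      rw [h] at h1
      obtain ⟨a, b, c⟩ := (hrun r hr).ext_of_isRootStart (hrun r' hr') h1 (hF r' hr')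
      exact Prod.ext a (Prod.ext b c)
  rw [Set.ncard_coe_finset, Finset.card_sdiff_of_subset, Finset.card_insert_of_notMem heS] at hle
  · simp at hle
    omega
  · intro x hx
    rcases Finset.mem_insert.1 hx with rfl | hx
    · exact Finset.mem_Icc.2 ⟨he1, hen⟩
    · exact (Finset.mem_filter.1 hx).1
end

section
/- Let ≺ be a total order on Σ, extended lexicographically to strings, and let w = uxyv be a Lyndon word w.r.t. ≺, where u, v are (possibly empty) strings and x, y are nonempty strings. If xy is a Lyndon word w.r.t. ≺ and yv is the lexicographically smallest (w.r.t. ≺) nonempty proper suffix of w, then u is the empty string. -/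
variable {α : Type*}

/-- A lexicographic inequality whose smaller side is not shorter comes from a mismatch, so it
survives appending arbitrary words. -/
theorem List.Lex.append_append_of_length_le {β : Type*} {r : β → β → Prop} {a b : List β}
    (h : List.Lex r a b) (hlen : b.length ≤ a.length) (c d : List β) :
    List.Lex r (a ++ c) (b ++ d) := by
  induction h with
  | nil => simp at hlen
  | rel h => exact .rel h
  | cons _ ih => exact .cons (ih (by simpa using hlen))

theorem runs_stmt13 {α : Type*} [LinearOrder α] (u x y v : List α)
    (hx : x ≠ []) (hy : y ≠ [])
    (hw : IsLyndon (· < ·) (u ++ x ++ y ++ v))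
    (hxy : IsLyndon (· < ·) (x ++ y))
    (hsuf : (y ++ v) <:+ (u ++ x ++ y ++ v))
    (hproper : y ++ v ≠ u ++ x ++ y ++ v)
    (hmin : ∀ s : List α, s ≠ [] → s <:+ (u ++ x ++ y ++ v) → s ≠ u ++ x ++ y ++ v →
      s = y ++ v ∨ List.Lex (· < ·) (y ++ v) s) :
    u = [] := by
  by_contra hu
  have hlt : List.Lex (· < ·) (x ++ y ++ v) (y ++ v) :=
    (hxy.2 y hy (by simpa using hx) (List.suffix_append x y)).append_append_of_length_le
      (by simp) v v
  rcases hmin (x ++ y ++ v) (by simp [hx]) ⟨u, by simp⟩ (by simpa using hu) with h | h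
  · exact hx (by simpa using h)
  · exact List.lt_asymm (show x ++ y ++ v < y ++ v from hlt) h
end

section
/- Let ≺ be a total order on Σ extended lexicographically to strings. Let f₀ be a Lyndon word w.r.t. ≺, let s be a nonempty string containing a symbol that occurs in neither f₀ nor elsewhere in s (a unique sentinel at its end), and let f₁ be the longest prefix of s that is a Lyndon word w.r.t. ≺. Then f₀ ≺ f₁ if and only if f₀·s ≺ s (where · is concatenation). -/
variable {α : Type*}

/-- `x` is smaller than `y` because of a letter in which they differ. -/
def MismatchLT {β : Type*} [LT β] (x y : List β) : Prop :=
  ∃ p a b x' y', x = p ++ a :: x' ∧ y = p ++ b :: y' ∧ a < b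

namespace MismatchLT

variable {β : Type*}

theorem append [LT β] {x y : List β} (h : MismatchLT x y) (s t : List β) :
    MismatchLT (x ++ s) (y ++ t) := by
  obtain ⟨p, a, b, x', y', rfl, rfl, hab⟩ := h
  exact ⟨p, a, b, x' ++ s, y' ++ t, by simp, by simp, hab⟩

theorem mono [LT β] {x y x' y' : List β} (h : MismatchLT x y) (hx : x <+: x') (hy : y <+: y') :
    MismatchLT x' y' := by
  obtain ⟨s, rfl⟩ := hx
  obtain ⟨t, rfl⟩ := hy
  exact h.append s t

theorem prepend [LT β] {x y : List β} (h : MismatchLT x y) (z : List β) :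
    MismatchLT (z ++ x) (z ++ y) := by
  obtain ⟨p, a, b, x', y', rfl, rfl, hab⟩ := h
  exact ⟨z ++ p, a, b, x', y', by simp, by simp, hab⟩

theorem lex [LT β] {x y : List β} (h : MismatchLT x y) : List.Lex (· < ·) x y := by
  obtain ⟨p, a, b, x', y', rfl, rfl, hab⟩ := h
  exact List.Lex.append_left _ (List.Lex.rel hab) p

theorem of_lex [LT β] {x y : List β} (h : List.Lex (· < ·) x y) : x <+: y ∨ MismatchLT x y := by
  induction h with
  | nil => exact Or.inl List.nil_prefix
  | @cons a l₁ l₂ _ ih =>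
    rcases ih with h | h
    · exact Or.inl ((List.prefix_cons_inj a).2 h)
    · exact Or.inr (h.prepend [a])
  | @rel a l₁ b l₂ hab => exact Or.inr ⟨[], a, b, l₁, l₂, rfl, rfl, hab⟩

theorem asymm [LinearOrder β] {x y : List β} (h : MismatchLT x y) : ¬ List.Lex (· < ·) y x :=
  fun h' => lt_asymm (a := x) (b := y) h.lex h'

theorem trichotomy [LinearOrder β] (x y : List β) :
    x <+: y ∨ y <+: x ∨ MismatchLT x y ∨ MismatchLT y x := by
  rcases lt_trichotomy x y with h | rfl | h
  · rcases of_lex h with h | h <;> simp [h]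
  · simp
  · rcases of_lex h with h | h <;> simp [h]

end MismatchLT

theorem IsLyndon.mismatchLT {β : Type*} [LinearOrder β] {u v : List β}
    (hu : IsLyndon (· < ·) u) (hv : v ≠ []) (hne : v ≠ u) (hsuf : v <:+ u) : MismatchLT u v := by
  rcases MismatchLT.of_lex (hu.2 v hv hne hsuf) with h | h
  · exact absurd (hsuf.eq_of_length (le_antisymm hsuf.length_le h.length_le)) hne
  · exact h

/-- The suffixes of a prefix of `f ^ ∞`, for `f` Lyndon, are not smaller than that prefix,
except by being shorter. -/
theorem IsLyndon.not_mismatchLT_suffix {β : Type*} [LinearOrder β] {f : List β}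
    (hf : IsLyndon (· < ·) f) (x y : List β) (hx : x <+: f ++ x) (hy : y <:+ x) :
    ¬ MismatchLT y x := by
  intro hM
  have irrefl : ∀ z : List β, ¬ MismatchLT z z := fun z h => h.asymm h.lex
  rcases List.prefix_or_prefix_of_prefix hx (List.prefix_append f x) with h | ⟨x', rfl⟩
  · obtain ⟨z, hz⟩ := h
    have hM' : MismatchLT (y ++ z) f := by
      have := hM.append z z
      rwa [hz] at this
    have hsuf : y ++ z <:+ f := by
      obtain ⟨w, hw⟩ := hy
      exact ⟨w, by rw [← hz, ← hw]; simp⟩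
    by_cases hne : y ++ z = f
    · exact irrefl f (hne ▸ hM')
    · have hnil : y ++ z ≠ [] := by
        intro h0
        obtain ⟨p, a, b, x', y', h1, -⟩ := hM'
        simp [h0] at h1
      exact hM'.asymm (hf.mismatchLT hnil hne hsuf).lex
  · have hx' : x' <+: f ++ x' := by simpa using hx
    have hpos : 0 < f.length := List.length_pos_iff.2 hf.1
    rcases List.suffix_or_suffix_of_suffix hy (List.suffix_append f x') with h | ⟨g, rfl⟩
    · refine hf.not_mismatchLT_suffix x' y hx' h ?_
      obtain ⟨p, a, b, r, t, h1, h2, hab⟩ := hM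
      have hlen : p.length < x'.length := by
        have := h.length_le
        rw [h1] at this
        simp at this
        omega
      have hp : p ++ [b] <+: x' := by
        refine List.prefix_of_prefix_length_le (l₃ := f ++ x') ⟨t, by simp [h2]⟩ hx' ?_
        simpa using hlen
      obtain ⟨t', ht'⟩ := hp
      exact ⟨p, a, b, r, t', h1, by simp [← ht'], hab⟩
    · have hg : g <:+ f := by
        obtain ⟨w, hw⟩ := hy
        exact ⟨w, by simpa [← List.append_assoc] using hw⟩
      by_cases hgf : g = f
      · subst hgf
        exact irrefl _ hM
      by_cases hg0 : g = []
      · subst hg0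
        refine hf.not_mismatchLT_suffix x' x' hx' List.suffix_rfl ?_
        obtain ⟨p, a, b, r, t, h1, h2, hab⟩ := hM
        simp only [List.nil_append] at h1
        have hp : p ++ [b] <+: x' := by
          refine List.prefix_of_prefix_length_le (l₃ := f ++ x') ⟨t, by simp [h2]⟩ hx' ?_
          simp [h1]
        obtain ⟨t', ht'⟩ := hp
        exact ⟨p, a, b, r, t', h1, by simp [← ht'], hab⟩
      · exact hM.asymm ((hf.mismatchLT hg0 hgf hg).append x' x').lex
termination_by x.length
decreasing_by all_goals subst_vars; simp; omega

/-- Increasing the letter that follows a prefix `u` of `f ^ ∞` gives a Lyndon word. -/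
theorem IsLyndon.append_singleton_of_lt {β : Type*} [LinearOrder β] {f u : List β} {a b : β}
    (hf : IsLyndon (· < ·) f) (hu : u ++ [a] <+: f ++ (u ++ [a])) (hab : a < b) :
    IsLyndon (· < ·) (u ++ [b]) := by
  refine ⟨by simp, fun w hw0 hwne hw => ?_⟩
  obtain rfl | ⟨v, rfl, hv⟩ := List.suffix_concat_iff.1 hw
  · exact absurd rfl hw0
  have hvlen : v.length < u.length := by
    refine lt_of_le_of_ne hv.length_le fun h => hwne ?_
    rw [hv.eq_of_length h]
  have hsuf : v ++ [a] <:+ u ++ [a] := by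
    obtain ⟨r, rfl⟩ := hv
    exact ⟨r, by simp⟩
  have hno := hf.not_mismatchLT_suffix _ _ hu hsuf
  rcases MismatchLT.trichotomy (u ++ [a]) (v ++ [a]) with h | h | h | h
  · have := h.length_le
    simp at this
    omega
  · have : v ++ [a] <+: u :=
      List.prefix_of_prefix_length_le h (List.prefix_append u [a]) (by simpa using hvlen)
    obtain ⟨r, rfl⟩ := this
    exact MismatchLT.lex ⟨v, a, b, r ++ [b], [], by simp, by simp, hab⟩
  · obtain ⟨p, c, d, x', y', h1, h2, hcd⟩ := h
    have hpl : p.length ≤ v.length := by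
      have := congrArg List.length h2
      simp at this
      omega
    have hpc : p ++ [c] <+: u :=
      List.prefix_of_prefix_length_le (l₃ := u ++ [a]) ⟨x', by simp [h1]⟩
        (List.prefix_append u [a]) (by simp; omega)
    obtain ⟨r, rfl⟩ := hpc
    rcases hpl.lt_or_eq with hpl | hpl
    · have hpd : p ++ [d] <+: v :=
        List.prefix_of_prefix_length_le (l₃ := v ++ [a]) ⟨y', by simp [h2]⟩
          (List.prefix_append v [a]) (by simp; omega)
      obtain ⟨t, rfl⟩ := hpd
      exact MismatchLT.lex ⟨p, c, d, r ++ [b], t ++ [b], by simp, by simp, hcd⟩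
    · obtain ⟨rfl, h3⟩ := List.append_inj h2 hpl.symm
      simp only [List.cons.injEq] at h3
      exact MismatchLT.lex ⟨v, c, b, r ++ [b], [], by simp, by simp,
        (h3.1 ▸ hcd).trans hab⟩
  · exact absurd h hno

theorem runs_stmt14 {α : Type*} [LinearOrder α] (f0 s f1 : List α)
    (hf0 : IsLyndon (· < ·) f0)
    (hs : s ≠ [])
    (hsent : ∃ (c : α) (s' : List α), s = s' ++ [c] ∧ c ∉ f0 ∧ c ∉ s')
    (hf1pre : f1 <+: s) (hf1lyn : IsLyndon (· < ·) f1)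
    (hf1long : ∀ g : List α, g <+: s → IsLyndon (· < ·) g → g.length ≤ f1.length) :
    List.Lex (· < ·) f0 f1 ↔ List.Lex (· < ·) (f0 ++ s) s := by
  obtain ⟨t, ht⟩ := hf1pre
  constructor
  · intro h
    rcases MismatchLT.of_lex h with ⟨v, hv⟩ | h'
    · have hv0 : v ≠ [] := by
        rintro rfl
        simp only [List.append_nil] at hv
        exact lt_irrefl f1 (hv ▸ h)
      have hM : MismatchLT f1 v :=
        hf1lyn.mismatchLT hv0 (by rintro rfl; exact hf0.1 (by simpa using hv)) ⟨f0, hv⟩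
      have hlt := ((hM.append t t).prepend f0).lex
      rwa [ht, ← List.append_assoc, hv, ht] at hlt
    · have := (h'.append s t).lex
      rwa [ht] at this
  · intro h
    have hnotpre : ¬ f0 ++ s <+: s := fun h => by
      have := h.length_le
      have hpos := List.length_pos_iff.2 hf0.1
      rw [List.length_append] at this
      omega
    obtain ⟨u, a, b, x', y', h1, h2, hab⟩ := (MismatchLT.of_lex h).resolve_left hnotpre
    have hus : u <+: s := ⟨b :: y', h2.symm⟩
    have hlyn : IsLyndon (· < ·) (u ++ [b]) := by
      refine hf0.append_singleton_of_lt (a := a) ?_ hab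
      have hfu : u ++ [a] <+: f0 ++ u := by
        refine List.prefix_of_prefix_length_le (l₃ := f0 ++ s) ⟨x', by simp [h1]⟩
          ((List.prefix_append_right_inj f0).2 hus) ?_
        have := List.length_pos_iff.2 hf0.1
        simp
        omega
      exact hfu.trans ((List.prefix_append_right_inj f0).2 (List.prefix_append u [a]))
    have hubs : u ++ [b] <+: s := ⟨y', by simp [h2]⟩
    have hub1 : u ++ [b] <+: f1 :=
      List.prefix_of_prefix_length_le hubs ⟨t, ht⟩ (hf1long _ hubs hlyn)
    have hf1f0 : ¬ f1 <+: f0 := fun hf => by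
      have heq := (List.prefix_of_prefix_length_le (l₁ := u ++ [a]) (l₂ := u ++ [b])
        (l₃ := f0 ++ s) ⟨x', by simp [h1]⟩
        ((hub1.trans hf).trans (List.prefix_append f0 s)) (by simp)).eq_of_length (by simp)
      simp only [List.append_cancel_left_eq, List.cons.injEq, and_true] at heq
      exact hab.ne heq
    rcases MismatchLT.trichotomy f0 f1 with ⟨v, hv⟩ | h' | h' | h'
    · have hv0 : v ≠ [] := by
        rintro rfl
        exact hf1f0 (by simp [← hv])
      obtain ⟨d, v, rfl⟩ := List.exists_cons_of_ne_nil hv0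
      have := List.Lex.append_left (· < ·) (List.Lex.nil (r := (· < ·)) (a := d) (l := v)) f0
      simpa [← hv] using this
    · exact absurd h' hf1f0
    · exact h'.lex
    · have := (h'.append t s).asymm
      rw [ht] at this
      exact absurd h this
end

section
/- For any run r = (i,j,p) of a string w and any total order ≺ on Σ, there exists at least one L-root of r with respect to ≺, i.e., an interval [iλ..jλ] with i ≤ iλ ≤ jλ ≤ j and jλ−iλ+1 = p such that w[iλ..jλ] is a Lyndon word w.r.t. ≺. -/
variable {α : Type*}

theorem List.Lex.prefix_or_append {α : Type*} {r : α → α → Prop} {u v : List α}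
    (h : List.Lex r u v) : u <+: v ∨ ∀ a b, List.Lex r (u ++ a) (v ++ b) := by
  induction h with
  | nil => exact Or.inl (List.nil_prefix)
  | rel h => exact Or.inr fun _ _ => List.Lex.rel h
  | cons _ ih =>
    rcases ih with ih | ih
    · exact Or.inl ((List.prefix_cons_inj _).2 ih)
    · exact Or.inr fun a b => List.Lex.cons (ih a b)

theorem List.Lex.of_append_left {α : Type*} {r : α → α → Prop} [Std.Irrefl r]
    {v x y : List α} (h : List.Lex r (v ++ x) (v ++ y)) : List.Lex r x y := by
  induction v with
  | nil => exact h
  | cons a v ih =>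
    cases h with
    | rel h => exact absurd h (irrefl a)
    | cons h => exact ih h

/-- A word strictly smaller than all of its nontrivial rotations is a Lyndon word. -/
theorem isLyndon_of_lex_rotate {α : Type*} (lt : α → α → Prop) [IsStrictTotalOrder α lt]
    {u : List α} (hu : u ≠ [])
    (h : ∀ k, 0 < k → k < u.length → List.Lex lt u (u.rotate k)) : IsLyndon lt u := by
  have rot : ∀ x y : List α, x ≠ [] → y ≠ [] → u = x ++ y → List.Lex lt u (y ++ x) := by
    rintro x y hx hy rfl
    have := h x.length (List.length_pos_iff.2 hx)
      (by simpa using List.length_pos_iff.2 hy)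
    rwa [List.rotate_append_length_eq] at this
  refine ⟨hu, fun v hv hvu ⟨x, hxv⟩ => ?_⟩
  have hx : x ≠ [] := by
    rintro rfl
    exact hvu hxv
  have hlt := rot x v hx hv hxv.symm
  rcases trichotomous_of (List.Lex lt) u v with huv | huv | huv
  · exact huv
  · exact absurd huv.symm hvu
  rcases huv.prefix_or_append with ⟨y, hy⟩ | hap
  · have hlen : y.length = x.length := by
      have := congrArg List.length (hy.trans hxv.symm)
      simp only [List.length_append] at this
      omega
    have hy0 : y ≠ [] := by
      rintro rfl
      exact hx (List.length_eq_zero_iff.1 hlen.symm)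
    have hyx : List.Lex lt y x := by
      rw [← hy] at hlt
      exact hlt.of_append_left
    rcases hyx.prefix_or_append with hpre | hap
    · rw [hpre.eq_of_length hlen] at hyx
      exact absurd hyx (irrefl x)
    · have := hap v v
      rw [hxv] at this
      exact absurd this (asymm (rot v y hv hy0 hy.symm))
  · have := hap x []
    rw [List.append_nil] at this
    exact absurd this (asymm hlt)

/-- Every word distinct from all of its nontrivial rotations has a Lyndon rotation. -/
theorem exists_isLyndon_rotate {α : Type*} (lt : α → α → Prop) [IsStrictTotalOrder α lt]
    {u : List α} (hu : u ≠ []) (h : ∀ k, 0 < k → k < u.length → u.rotate k ≠ u) :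
    ∃ s < u.length, IsLyndon lt (u.rotate s) := by
  have hpos := List.length_pos_iff.2 hu
  have : IsTrans (List α) (List.Lex lt) :=
    ⟨fun _ _ _ h₁ h₂ => List.lex_trans (fun h₁ h₂ => trans_of lt h₁ h₂) h₁ h₂⟩
  have : IsStrictOrder (List α) (List.Lex lt) := {}
  obtain ⟨⟨_, s, hs, rfl⟩, -, hmin⟩ := (((Set.finite_lt_nat u.length).image
    u.rotate).wellFoundedOn (r := List.Lex lt)).has_min Set.univ ⟨⟨_, 0, hpos, rfl⟩, trivial⟩
  have hs : s < u.length := hs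
  refine ⟨s, hs, isLyndon_of_lex_rotate lt (by simpa using hu) fun k hk hku => ?_⟩
  rw [List.length_rotate] at hku
  rcases trichotomous_of (List.Lex lt) (u.rotate s) ((u.rotate s).rotate k) with hlt | heq | hgt
  · exact hlt
  · refine absurd (List.rotate_injective s ?_) (h k hk hku)
    simp only [List.rotate_rotate] at heq ⊢
    rw [add_comm k s, ← heq]
  · refine absurd hgt (hmin ⟨(u.rotate s).rotate k, (s + k) % u.length, Nat.mod_lt _ hpos, ?_⟩ trivial)
    rw [List.rotate_mod, List.rotate_rotate]

theorem IsPeriod.eq_mod {α : Type*} {w : ℕ → α} {i j p : ℕ} (h : IsPeriod w i j p) (k : ℕ)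
    (hk : i + k ≤ j) : w (i + k) = w (i + k % p) := by
  induction k using Nat.strong_induction_on with
  | _ k ih =>
    rcases lt_or_ge k p with hkp | hkp
    · rw [Nat.mod_eq_of_lt hkp]
    · rcases Nat.eq_zero_or_pos p with rfl | hp
      · simp
      · rw [Nat.mod_eq_sub_mod hkp, ← ih (k - p) (by omega) (by omega),
          h (i + (k - p)) (by omega) (by omega)]
        congr 1
        omega

theorem IsPeriod.substr_rotate {α : Type*} {w : ℕ → α} {i j p s : ℕ} (h : IsPeriod w i j p)
    (hs : i + s + p ≤ j + 1) (hp : 0 < p) :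
    (substr w i (i + p - 1)).rotate s = substr w (i + s) (i + s + p - 1) := by
  apply List.ext_getElem
  · simp only [substr, List.length_rotate, List.length_map, List.length_range]
    omega
  · intro k _ hk
    simp only [substr, List.length_map, List.length_range] at hk
    have hlen : i + p - 1 + 1 - i = p := by omega
    simp only [substr, List.getElem_rotate, List.getElem_map, List.getElem_range,
      List.length_map, List.length_range, hlen]
    rw [← h.eq_mod (k + s) (by omega)]
    congr 1
    omega

theorem runs_stmt16 {α : Type*} (lt : α → α → Prop) [IsStrictTotalOrder α lt]
    (n : ℕ) (w : ℕ → α) (i j p : ℕ) (hrun : IsRun w n i j p) :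
    ∃ iℓ jℓ, IsLRoot lt w i j p iℓ jℓ := by
  obtain ⟨-, -, hp, hij, hper, hmin, -, -⟩ := hrun
  have hlen : (substr w i (i + p - 1)).length = p := by
    simp only [substr, List.length_map, List.length_range]
    omega
  obtain ⟨s, hs, hlyn⟩ := exists_isLyndon_rotate lt (u := substr w i (i + p - 1))
    (List.length_pos_iff.1 (by omega)) (by
      intro q hq hqp heq
      rw [hlen] at hqp
      refine hmin q hq hqp fun k hk hkq => ?_
      have hm := Nat.mod_lt (k - i) hp
      have hget := List.getElem_of_eq heq (i := (k - i) % p) (by simpa [hlen] using hm)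
      simp only [List.getElem_rotate, hlen] at hget
      simp only [substr, List.getElem_map, List.getElem_range, Nat.mod_add_mod] at hget
      rw [← hper.eq_mod _ (by omega), ← hper.eq_mod _ (by omega)] at hget
      rw [show k + q = i + (k - i + q) by omega, hget]
      congr 1
      omega)
  rw [hlen] at hs
  rw [hper.substr_rotate (by omega) hp] at hlyn
  exact ⟨i + s, i + s + p - 1, by omega, by omega, by omega, hlyn⟩
end

section
/- For any string w of length n and any interval [i..j] with 1 ≤ i ≤ j ≤ n, there is at most one run r = (i′, j′, p′) of w satisfying i′ ≤ i, j ≤ j′, and p′ ≤ (j − i + 1)/2. -/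
variable {α : Type*}

/-- Weak Fine–Wilf step: if `p ≤ q` are periods and the interval has length at least `p + q`,
then `q - p` is a period. -/
lemma IsPeriod.sub {w : ℕ → α} {i j p q : ℕ} (hp : IsPeriod w i j p) (hq : IsPeriod w i j q)
    (hpq : p ≤ q) (hlen : i + p + q ≤ j + 1) : IsPeriod w i j (q - p) := by
  intro k hik hkj
  by_cases hk : i + p ≤ k
  · have e1 := hp (k - p) (by omega) (by omega)
    have e2 := hq (k - p) (by omega) (by omega)
    rw [show k - p + p = k by omega] at e1
    rw [show k - p + q = k + (q - p) by omega] at e2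
    rw [← e1, e2]
  · have e1 := hq k hik (by omega)
    have e2 := hp (k + (q - p)) (by omega) (by omega)
    rw [show k + (q - p) + p = k + q by omega] at e2
    rw [e1, e2]

/-- Weak Fine–Wilf theorem. -/
lemma IsPeriod.gcd {w : ℕ → α} {i j p q : ℕ} (hp : IsPeriod w i j p) (hq : IsPeriod w i j q)
    (hlen : i + p + q ≤ j + 1) : IsPeriod w i j (Nat.gcd p q) := by
  induction hs : p + q using Nat.strong_induction_on generalizing p q with
  | _ s ih =>
    rcases Nat.eq_zero_or_pos p with rfl | hp0
    · simpa using hq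
    rcases Nat.eq_zero_or_pos q with rfl | hq0
    · simpa using hp
    rcases le_total p q with hpq | hqp
    · have := ih (p + (q - p)) (by omega) hp (hp.sub hq hpq hlen) (by omega) rfl
      rwa [Nat.gcd_sub_self_right hpq] at this
    · have := ih (p - q + q) (by omega) (hq.sub hp hqp (by omega)) hq (by omega) rfl
      rwa [Nat.gcd_sub_self_left hqp] at this

/-- A period `g ≤ p` of a window of length at least `2 * p` extends to any larger interval
having period `p`. -/
lemma IsPeriod.extend {w : ℕ → α} {i j a b p g : ℕ} (hp : IsPeriod w a b p)
    (hg : IsPeriod w i j g) (hp0 : 1 ≤ p) (hgp : g ≤ p) (hai : a ≤ i) (hjb : j ≤ b)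
    (hlen : i + 2 * p ≤ j + 1) : IsPeriod w a b g := by
  have right : ∀ k, i ≤ k → k + g ≤ b → w k = w (k + g) := by
    intro k
    induction k using Nat.strong_induction_on with
    | _ k ih =>
      intro hik hkb
      by_cases hk : k < i + p
      · exact hg k hik (by omega)
      · have e := ih (k - p) (by omega) (by omega) (by omega)
        have e1 := hp (k - p) (by omega) (by omega)
        have e2 := hp (k - p + g) (by omega) (by omega)
        rw [show k - p + p = k by omega] at e1
        rw [show k - p + g + p = k + g by omega] at e2
        rw [← e1, e, e2]
  intro k
  induction hd : i - k using Nat.strong_induction_on generalizing k with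
  | _ d ih =>
    intro hak hkb
    by_cases hk : i ≤ k
    · exact right k hk hkb
    · have e := ih (i - (k + p)) (by omega) (k + p) rfl (by omega) (by omega)
      have e1 := hp k hak (by omega)
      have e2 := hp (k + g) (by omega) (by omega)
      rw [show k + g + p = k + p + g by omega] at e2
      rw [e1, e, e2]

/-- The minimal period of a run is at most every period of a window of length at least
twice that minimal period. -/
lemma IsRun.le_of_isPeriod {w : ℕ → α} {n a b p i j g : ℕ} (hr : IsRun w n a b p)
    (hg : IsPeriod w i j g) (hg0 : 1 ≤ g) (hai : a ≤ i) (hjb : j ≤ b)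
    (hlen : i + 2 * p ≤ j + 1) : p ≤ g := by
  obtain ⟨-, -, hp0, -, hp, hmin, -, -⟩ := hr
  by_contra! hlt
  exact hmin g hg0 hlt (hp.extend hg hp0 hlt.le hai hjb hlen)

/-- A run with period `p` extends at least as far as any interval with period `p` that
overlaps it in at least `p` positions. -/
lemma IsRun.maximal {w : ℕ → α} {n a b c d p i j : ℕ} (hr : IsRun w n a b p)
    (hp : IsPeriod w c d p) (hc : 1 ≤ c) (hd : d ≤ n) (hai : a ≤ i) (hjb : j ≤ b)
    (hci : c ≤ i) (hjd : j ≤ d) (hlen : i + p ≤ j + 1) : a ≤ c ∧ d ≤ b := by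
  obtain ⟨ha, hb, hp0, -, -, -, hleft, hright⟩ := hr
  constructor
  · by_contra! h
    refine (hleft.resolve_left (by omega)) ?_
    have e := hp (a - 1) (by omega) (by omega)
    rwa [show a - 1 + p = a + p - 1 by omega] at e
  · by_contra! h
    refine (hright.resolve_left (by omega)) ?_
    have e := hp (b - p + 1) (by omega) (by omega)
    rw [show b - p + 1 + p = b + 1 by omega] at e
    exact e.symm

theorem runs_stmt17 {α : Type*} (n : ℕ) (w : ℕ → α) (i j : ℕ)
    (h1 : 1 ≤ i) (hij : i ≤ j) (hjn : j ≤ n)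
    (i' j' p' i'' j'' p'' : ℕ)
    (hr' : IsRun w n i' j' p') (hr'' : IsRun w n i'' j'' p'')
    (hcov' : i' ≤ i ∧ j ≤ j' ∧ 2 * p' ≤ j + 1 - i)
    (hcov'' : i'' ≤ i ∧ j ≤ j'' ∧ 2 * p'' ≤ j + 1 - i) :
    (i', j', p') = (i'', j'', p'') := by
  obtain ⟨hi', hj', hl'⟩ := hcov'
  obtain ⟨hi'', hj'', hl''⟩ := hcov''
  have ⟨ha', hb', hp0', _, hp', _⟩ := hr'
  have ⟨ha'', hb'', hp0'', _, hp'', _⟩ := hr''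
  have hg : IsPeriod w i j (Nat.gcd p' p'') :=
    IsPeriod.gcd (fun k h h' => hp' k (by omega) (by omega))
      (fun k h h' => hp'' k (by omega) (by omega)) (by omega)
  have hg0 : 1 ≤ Nat.gcd p' p'' := Nat.gcd_pos_of_pos_left _ hp0'
  have hle' := hr'.le_of_isPeriod hg hg0 hi' hj' (by omega)
  have hle'' := hr''.le_of_isPeriod hg hg0 hi'' hj'' (by omega)
  have hge' := Nat.gcd_le_left p'' hp0'
  have hge'' := Nat.gcd_le_right p' hp0''
  obtain rfl : p' = p'' := by omega
  obtain ⟨m1, m2⟩ := hr'.maximal hp'' ha'' hb'' hi' hj' hi'' hj'' (by omega)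
  obtain ⟨m3, m4⟩ := hr''.maximal hp' ha' hb' hi'' hj'' hi' hj' (by omega)
  rw [le_antisymm m1 m3, le_antisymm m4 m2]
end
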